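/- arXiv:2405.10869 — 4 statements merged into one kernel-verified Lean document; each statement's English description precedes it below -/
import Mathlib

section
/- Let Q : ℝ → ℝ be continuous and let c be a real number with 0 ≤ c ≤ 2. Then ∫_{t=0}^{2} ∫_{u=0}^{(c+t−2)⁺} u·(c + 2t − 2)·Q(u) du dt + ∫_{t=0}^{2} ∫_{y=1−c}^{max(t−1, 1−c)} y·(t − 1 − y)·Q(t − 1 − y) dy dt − ∫_{t=0}^{2} ∫_{u=0}^{t} t·(c + u − 2)⁺·Q(c + u − 2) du dt = ∫_{t=0}^{c} ∫_{u=0}^{t} u·(2t − u + 1 − c)·Q(u) du dt. -/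
open intervalIntegral

lemma aux_neg (h : ℝ → ℝ) (hz : ∀ v ≤ 0, h v = 0) (a b : ℝ) (ha : a ≤ 0) (hb : b ≤ 0) :
    ∫ v in a..b, h v = 0 := by
  rw [integral_congr (g := fun _ => (0:ℝ))]
  · simp
  · intro v hv
    exact hz v (hv.2.trans (max_le ha hb))

lemma aux_split (h : ℝ → ℝ) (hh : Continuous h) (hz : ∀ v ≤ 0, h v = 0) (a b : ℝ) (ha : a ≤ 0) :
    ∫ v in a..b, h v = ∫ v in (0:ℝ)..(max b 0), h v := by
  rcases le_total b 0 with hb | hb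
  · rw [max_eq_right hb, aux_neg h hz a b ha hb, integral_same]
  · rw [max_eq_left hb, ← integral_add_adjacent_intervals (hh.intervalIntegrable a 0)
      (hh.intervalIntegrable 0 b), aux_neg h hz a 0 ha le_rfl, zero_add]

/-- The paper's displayed computation of the boundary contribution
D_{{1,i,n+1}}(a) with c = a₁ + aᵢ. -/
theorem stmt_5 (Q : ℝ → ℝ) (hQ : Continuous Q) (c : ℝ) (hc0 : 0 ≤ c) (hc2 : c ≤ 2) :
    (∫ t in (0:ℝ)..2, ∫ u in (0:ℝ)..(max (c + t - 2) 0), u * (c + 2*t - 2) * Q u)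
      + (∫ t in (0:ℝ)..2, ∫ y in (1 - c)..(max (t - 1) (1 - c)),
          y * (t - 1 - y) * Q (t - 1 - y))
      - (∫ t in (0:ℝ)..2, ∫ u in (0:ℝ)..t, t * (max (c + u - 2) 0) * Q (c + u - 2))
      = ∫ t in (0:ℝ)..c, ∫ u in (0:ℝ)..t, u * (2*t - u + 1 - c) * Q u := by
  have h2 : ∀ t : ℝ, (∫ y in (1 - c)..(max (t - 1) (1 - c)), y * (t - 1 - y) * Q (t - 1 - y))
      = ∫ u in (0:ℝ)..(max (c + t - 2) 0), (t - 1 - u) * u * Q u := by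
    intro t
    have := integral_comp_sub_left (a := 1 - c) (b := max (t - 1) (1 - c))
      (fun u => (t - 1 - u) * u * Q u) (t - 1)
    simp only [sub_sub_cancel] at this
    rw [this]
    rcases le_total (c + t - 2) 0 with h | h
    · rw [max_eq_right h, max_eq_right (by linarith)]
      simp
    · rw [max_eq_left h, max_eq_left (by linarith)]
      congr 1 <;> ring
  have h3 : ∀ t : ℝ, (∫ u in (0:ℝ)..t, t * (max (c + u - 2) 0) * Q (c + u - 2))
      = ∫ u in (0:ℝ)..(max (c + t - 2) 0), t * u * Q u := by
    intro t
    have := integral_comp_add_left (a := 0) (b := t)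
      (fun u => t * (max u 0) * Q u) (c - 2)
    have e : ∀ u : ℝ, c - 2 + u = c + u - 2 := fun u => by ring
    simp only [e] at this
    rw [this, aux_split _ (by fun_prop) (fun v hv => by simp [hv]) _ _ (by linarith)]
    apply integral_congr
    intro v hv
    have : 0 ≤ v := by
      have := hv.1
      simpa using this
    simp [max_eq_left this]
  simp only [h2, h3]
  have k : ∀ f : ℝ → ℝ → ℝ, Continuous (Function.uncurry f) →
      Continuous fun t => ∫ u in (0:ℝ)..(max (c + t - 2) 0), f t u := fun f hf =>
    continuous_parametric_intervalIntegral_of_continuous hf (by fun_prop)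
  have k1 := k (fun t u => u * (c + 2*t - 2) * Q u) (by unfold Function.uncurry; fun_prop)
  have k2 := k (fun t u => (t - 1 - u) * u * Q u) (by unfold Function.uncurry; fun_prop)
  have k3 := k (fun t u => t * u * Q u) (by unfold Function.uncurry; fun_prop)
  rw [← integral_add (k1.intervalIntegrable _ _) (k2.intervalIntegrable _ _),
    ← integral_sub ((k1.fun_add k2).intervalIntegrable _ _) (k3.intervalIntegrable _ _)]
  set G : ℝ → ℝ := fun s => ∫ u in (0:ℝ)..s, u * (2*s - u + 1 - c) * Q u with hG
  have hGc : Continuous G :=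
    continuous_parametric_intervalIntegral_of_continuous
      (f := fun s u => u * (2*s - u + 1 - c) * Q u)
      (by unfold Function.uncurry; fun_prop) continuous_id
  have hp : ∀ t : ℝ, ((∫ u in (0:ℝ)..(max (c + t - 2) 0), u * (c + 2*t - 2) * Q u)
      + (∫ u in (0:ℝ)..(max (c + t - 2) 0), (t - 1 - u) * u * Q u))
      - (∫ u in (0:ℝ)..(max (c + t - 2) 0), t * u * Q u) = G (max (c - 2 + t) 0) := by
    intro t
    rw [← integral_add (Continuous.intervalIntegrable (by fun_prop) _ _)
        (Continuous.intervalIntegrable (by fun_prop) _ _),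
      ← integral_sub (Continuous.intervalIntegrable (by fun_prop) _ _)
        (Continuous.intervalIntegrable (by fun_prop) _ _)]
    have e : c - 2 + t = c + t - 2 := by ring
    simp only [hG, e]
    rcases le_total (c + t - 2) 0 with h | h
    · rw [max_eq_right h]; simp
    · rw [max_eq_left h]
      congr 1
      funext u
      ring
  simp only [hp]
  rw [integral_comp_add_left (fun s => G (max s 0)) (c - 2),
    aux_split _ (by fun_prop) (fun v hv => by simp [hv, hG]) _ _ (by linarith)]
  have e : max (c - 2 + 2) 0 = c := by rw [sub_add_cancel, max_eq_left hc0]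
  rw [e]
  apply integral_congr
  intro v hv
  rw [Set.uIcc_of_le hc0] at hv
  simp [max_eq_left hv.1, hG]
end

section
/- Let Q : ℝ → ℝ be continuous and define F : ℝ → ℝ by F(c) := ∫_{t=0}^{c} ∫_{u=0}^{t} u·(2t − u + 1 − c)·Q(u) du dt. Then F is differentiable on ℝ and F'(c) = ∫_{u=0}^{c} u·Q(u) du for every c ∈ ℝ. -/
open intervalIntegral

/-- Differentiation-under-the-integral identity: with
`F c = ∫₀ᶜ ∫₀ᵗ u·(2t − u + 1 − c)·Q(u) du dt`, `F` is differentiable with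
`F'(c) = ∫₀ᶜ u·Q(u) du`. -/
theorem stmt_6 (Q : ℝ → ℝ) (hQ : Continuous Q) (F : ℝ → ℝ)
    (hF : ∀ c : ℝ, F c = ∫ t in (0:ℝ)..c, ∫ u in (0:ℝ)..t,
      u * (2*t - u + 1 - c) * Q u) :
    ∀ c : ℝ, HasDerivAt F (∫ u in (0:ℝ)..c, u * Q u) c := by
  have ftc : ∀ g : ℝ → ℝ, Continuous g → ∀ c : ℝ,
      HasDerivAt (fun x => ∫ u in (0:ℝ)..x, g u) (g c) c := fun g hg c =>
    integral_hasDerivAt_right (hg.intervalIntegrable _ _)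
      hg.stronglyMeasurable.stronglyMeasurableAtFilter hg.continuousAt
  have hq1 : Continuous fun u : ℝ => u * Q u := by fun_prop
  have hq2 : Continuous fun u : ℝ => u * u * Q u := by fun_prop
  obtain ⟨A, hA⟩ : ∃ A : ℝ → ℝ, A = fun x => ∫ u in (0:ℝ)..x, u * Q u := ⟨_, rfl⟩
  obtain ⟨B, hB⟩ : ∃ B : ℝ → ℝ, B = fun x => ∫ u in (0:ℝ)..x, u * u * Q u := ⟨_, rfl⟩
  have dA : ∀ c, HasDerivAt A (c * Q c) c := fun c => by rw [hA]; exact ftc _ hq1 c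
  have dB : ∀ c, HasDerivAt B (c * c * Q c) c := fun c => by rw [hB]; exact ftc _ hq2 c
  have cA : Continuous A := continuous_iff_continuousAt.2 fun c => (dA c).continuousAt
  have cB : Continuous B := continuous_iff_continuousAt.2 fun c => (dB c).continuousAt
  have A0 : A 0 = 0 := by simp [hA]
  have B0 : B 0 = 0 := by simp [hB]
  have inner : ∀ c t : ℝ, (∫ u in (0:ℝ)..t, u * (2*t - u + 1 - c) * Q u)
      = ((2*t+1) * A t - B t) - c * A t := by
    intro c t
    have : ∀ u : ℝ, u * (2*t - u + 1 - c) * Q u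
        = (2*t+1-c) * (u * Q u) - u * u * Q u := fun u => by ring
    simp only [this]
    rw [integral_sub ((hq1.const_mul _).intervalIntegrable _ _) (hq2.intervalIntegrable _ _),
      integral_const_mul, hA, hB]
    ring
  have IA : ∀ c : ℝ, (∫ t in (0:ℝ)..c, A t) = c * A c - B c := by
    intro c
    have h := integral_eq_sub_of_hasDerivAt (a := 0) (b := c)
      (f := fun t => t * A t - B t) (f' := A) (fun t _ => by
        have := ((hasDerivAt_id t).mul (dA t)).sub (dB t)
        refine this.congr_deriv ?_
        simp only [id]; ring) (cA.intervalIntegrable _ _)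
    rw [h, A0, B0]; ring
  have hG : Continuous fun t : ℝ => (2*t+1) * A t - B t := by fun_prop
  have hF' : F = fun c => (∫ t in (0:ℝ)..c, ((2*t+1) * A t - B t)) - c * (c * A c - B c) := by
    funext c
    rw [hF c]
    simp only [inner]
    rw [integral_sub (hG.intervalIntegrable _ _) ((cA.const_mul c).intervalIntegrable _ _),
      integral_const_mul, IA]
  intro c
  have key : HasDerivAt F (A c) c := by
    rw [hF']
    have := (ftc _ hG c).sub ((hasDerivAt_id c).mul (((hasDerivAt_id c).mul (dA c)).sub (dB c)))
    refine this.congr_deriv ?_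
    simp only [id, Pi.mul_apply, Pi.sub_apply]; ring
  rw [hA] at key
  exact key
end

section
/- Let Q : ℝ → ℝ be continuous, define F : ℝ → ℝ by F(c) := ∫_{t=0}^{c} ∫_{u=0}^{t} u·(2t − u + 1 − c)·Q(u) du dt, and let c', c be real numbers. Then F(c) − F(c') = ∫_{s=c'}^{c} ( ∫_{u=0}^{s} u·Q(u) du ) ds. -/
open intervalIntegral

/-- Integrated form: with `F c = ∫₀ᶜ ∫₀ᵗ u·(2t − u + 1 − c)·Q(u) du dt`,
`F(c) − F(c') = ∫_{c'}^{c} (∫₀ˢ u·Q(u) du) ds`. -/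
theorem stmt_7 (Q : ℝ → ℝ) (hQ : Continuous Q) (F : ℝ → ℝ)
    (hF : ∀ c : ℝ, F c = ∫ t in (0:ℝ)..c, ∫ u in (0:ℝ)..t,
      u * (2*t - u + 1 - c) * Q u)
    (c' c : ℝ) :
    F c - F c' = ∫ s in c'..c, ∫ u in (0:ℝ)..s, u * Q u := by
  have h1 : Continuous (fun u : ℝ => u * Q u) := by fun_prop
  have h2 : Continuous (fun u : ℝ => u * (u * Q u)) := by fun_prop
  obtain ⟨A, hA⟩ : ∃ A : ℝ → ℝ, A = fun t => ∫ u in (0:ℝ)..t, u * Q u := ⟨_, rfl⟩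
  obtain ⟨B, hB⟩ : ∃ B : ℝ → ℝ, B = fun t => ∫ u in (0:ℝ)..t, u * (u * Q u) := ⟨_, rfl⟩
  have dA : ∀ t, HasDerivAt A (t * Q t) t := fun t => by
    rw [hA]; exact h1.integral_hasStrictDerivAt 0 t |>.hasDerivAt
  have dB : ∀ t, HasDerivAt B (t * (t * Q t)) t := fun t => by
    rw [hB]; exact h2.integral_hasStrictDerivAt 0 t |>.hasDerivAt
  have cA : Continuous A := continuous_iff_continuousAt.2 fun t => (dA t).continuousAt
  obtain ⟨P, hP⟩ : ∃ P : ℝ → ℝ, P = fun t => ∫ u in (0:ℝ)..t, A u := ⟨_, rfl⟩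
  have dP : ∀ t, HasDerivAt P (A t) t := fun t => by
    rw [hP]; exact cA.integral_hasStrictDerivAt 0 t |>.hasDerivAt
  have cP : Continuous P := continuous_iff_continuousAt.2 fun t => (dP t).continuousAt
  have B0 : B 0 = 0 := by simp [hB]
  have P0 : P 0 = 0 := by simp [hP]
  have hPAB : ∀ t, P t = t * A t - B t := fun t => by
    have := integral_eq_sub_of_hasDerivAt (a := 0) (b := t) (f := fun t => t * A t - B t) (f' := A)
      (fun x _ => by
        have := ((hasDerivAt_id' x).mul (dA x)).sub (dB x)
        refine HasDerivAt.congr_deriv (f := _) this ?_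
        ring) (cA.intervalIntegrable _ _)
    rw [hP]
    simpa [B0] using this
  have key : ∀ c, F c = P c := fun c => by
    have inner : ∀ t, (∫ u in (0:ℝ)..t, u * (2*t - u + 1 - c) * Q u)
        = t * A t + P t + (1 - c) * A t := fun t => by
      have e : (fun u => u * (2*t - u + 1 - c) * Q u)
          = fun u => (2*t+1-c) * (u * Q u) - u * (u * Q u) := by
        funext u; ring
      rw [e, integral_sub ((h1.const_mul _).intervalIntegrable _ _) (h2.intervalIntegrable _ _),
        integral_const_mul, hPAB]
      simp only [hA, hB]
      ring
    rw [hF]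
    simp only [inner]
    rw [integral_eq_sub_of_hasDerivAt (f := fun t => t * P t + (1 - c) * P t)
      (fun x _ => by
        have := ((hasDerivAt_id' x).mul (dP x)).add ((dP x).const_mul (1 - c))
        refine HasDerivAt.congr_deriv (f := _) this ?_
        ring) ((by fun_prop : Continuous _).intervalIntegrable _ _)]
    simp only [P0]
    ring
  have := integral_eq_sub_of_hasDerivAt (a := c') (b := c) (fun x _ => dP x)
    (cA.intervalIntegrable _ _)
  rw [key, key, ← this, hA]
end

section
/- Let R : ℝ × ℝ → ℝ be continuous and symmetric, i.e. R(x,y) = R(y,x) for all x, y ∈ ℝ, and let a be a real number with 0 ≤ a ≤ 1. Then ∫_{t=0}^{2} ∫_{y=0}^{(t−1)⁺} ∫_{u=0}^{(y+a−1)⁺} y·u·(t − 1 − y)·R(u, t − 1 − y) du dy dt + ∫_{t=0}^{2} ∫_{u=0}^{(a+t−2)⁺} ∫_{y=0}^{u} (y·(u − y)/2)·(a + t − 1)·R(y, u − y) dy du dt − ∫_{t=0}^{2} ∫_{u=0}^{t} ∫_{y=0}^{(a+u−2)⁺} (t·y·(a + u − 2 − y)/2)·R(y, a + u − 2 − y)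 dy du dt = ∫_{t=0}^{a} ∫_{u=0}^{t} ∫_{y=0}^{u} (t − y + 1 − a + (a − 1)/2)·(u − y)·y·R(y, u − y) dy du dt. -/
open intervalIntegral
open MeasureTheory Set in
lemma tri_swap (f : ℝ → ℝ → ℝ) (hf : Continuous (Function.uncurry f)) (r : ℝ) (hr : 0 ≤ r) :
    (∫ z in (0:ℝ)..r, ∫ u in (0:ℝ)..z, f z u) = ∫ u in (0:ℝ)..r, ∫ z in u..r, f z u := by
  let F : ℝ → ℝ → ℝ := fun z u => if u ≤ z then f z u else 0
  have h1 : (∫ z in (0:ℝ)..r, ∫ u in (0:ℝ)..z, f z u) = ∫ z in (0:ℝ)..r, ∫ u in (0:ℝ)..r, F z u := by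
    apply integral_congr
    intro z hz
    rw [uIcc_of_le hr] at hz
    simp only [integral_of_le hz.1, integral_of_le hr]
    have : (fun u => F z u) = (Iic z).indicator (f z) := by
      ext u; simp [F, indicator]
    rw [this, setIntegral_indicator measurableSet_Iic]
    congr 2
    ext u; simp only [mem_Ioc, mem_inter_iff, mem_Iic]
    constructor
    · rintro ⟨h, h'⟩; exact ⟨⟨h, h'.trans hz.2⟩, h'⟩
    · rintro ⟨⟨h, _⟩, h'⟩; exact ⟨h, h'⟩
  have h2 : (∫ u in (0:ℝ)..r, ∫ z in u..r, f z u) = ∫ u in (0:ℝ)..r, ∫ z in (0:ℝ)..r, F z u := by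
    apply intervalIntegral.integral_congr_ae
    refine Filter.Eventually.of_forall fun u hz => ?_
    rw [uIoc_of_le hr] at hz
    rw [integral_of_le hz.2, integral_of_le hr, ← integral_Icc_eq_integral_Ioc]
    have : (fun z => F z u) = (Ici u).indicator (fun z => f z u) := by
      ext u; simp [F, indicator]
    rw [this, setIntegral_indicator measurableSet_Ici]
    congr 2
    ext z; simp only [mem_Ioc, mem_Icc, mem_inter_iff, mem_Ici]
    constructor
    · rintro ⟨h, h'⟩; exact ⟨⟨hz.1.trans_le h, h'⟩, h⟩
    · rintro ⟨⟨_, h⟩, h'⟩; exact ⟨h', h⟩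
  rw [h1, h2]
  apply MeasureTheory.intervalIntegral_intervalIntegral_swap
  rw [uIoc_of_le hr]
  have : (Function.uncurry F) = {p : ℝ × ℝ | p.2 ≤ p.1}.indicator (Function.uncurry f) := by
    ext p; simp [F, indicator, Function.uncurry]
  rw [this]
  refine IntegrableOn.indicator ?_ (measurableSet_le measurable_snd measurable_fst)
  have : IntegrableOn (Function.uncurry f) (Icc 0 r ×ˢ Icc 0 r) volume :=
    hf.continuousOn.integrableOn_compact (isCompact_Icc.prod isCompact_Icc)
  exact this.mono_set (prod_mono Ioc_subset_Icc_self Ioc_subset_Icc_self)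

open MeasureTheory Set in
lemma shift_int (f g : ℝ → ℝ) (hg : Continuous g) (c b : ℝ) (hc : 0 ≤ c) (hb : c ≤ b)
    (h0 : ∀ x, x ≤ c → f x = 0) (h1 : ∀ x, 0 ≤ x → x ≤ b - c → f (x + c) = g x) :
    (∫ x in (0:ℝ)..b, f x) = ∫ x in (0:ℝ)..(b - c), g x := by
  have e1 : EqOn f (fun _ => 0) (uIcc 0 c) := by
    intro x hx; rw [uIcc_of_le hc] at hx; exact h0 x hx.2
  have e2 : EqOn f (fun x => g (x - c)) (uIcc c b) := by
    intro x hx; rw [uIcc_of_le hb] at hx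
    have := h1 (x - c) (by linarith [hx.1]) (by linarith [hx.2])
    simpa using this
  have i1 : IntervalIntegrable f volume 0 c :=
    (intervalIntegrable_const (c := (0:ℝ))).congr (e1.symm.mono uIoc_subset_uIcc)
  have i2 : IntervalIntegrable f volume c b :=
    (Continuous.intervalIntegrable (by fun_prop) c b : IntervalIntegrable (fun x => g (x - c)) volume c b).congr (e2.symm.mono uIoc_subset_uIcc)
  rw [← integral_add_adjacent_intervals i1 i2, integral_congr e1, integral_congr e2,
    integral_comp_sub_right (fun x => g x)]
  simp

theorem stmt_14 (R : ℝ × ℝ → ℝ) (hR : Continuous R)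
    (hsymm : ∀ x y : ℝ, R (x, y) = R (y, x)) (a : ℝ)
    (ha : 0 ≤ a) (ha' : a ≤ 1) :
    (∫ t in (0:ℝ)..2, ∫ y in (0:ℝ)..(max (t - 1) 0),
        ∫ u in (0:ℝ)..(max (y + a - 1) 0), y * u * (t - 1 - y) * R (u, t - 1 - y))
      + (∫ t in (0:ℝ)..2, ∫ u in (0:ℝ)..(max (a + t - 2) 0),
          ∫ y in (0:ℝ)..u, (y * (u - y) / 2) * (a + t - 1) * R (y, u - y))
      - (∫ t in (0:ℝ)..2, ∫ u in (0:ℝ)..t, ∫ y in (0:ℝ)..(max (a + u - 2) 0),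
          (t * y * (a + u - 2 - y) / 2) * R (y, a + u - 2 - y))
      = ∫ t in (0:ℝ)..a, ∫ u in (0:ℝ)..t, ∫ y in (0:ℝ)..u,
          (t - y + 1 - a + (a - 1) / 2) * (u - y) * y * R (y, u - y) := by
  obtain ⟨G, hG⟩ : ∃ G : ℝ → ℝ, G = fun u => ∫ y in (0:ℝ)..u, y * (u - y) * R (y, u - y) := ⟨_, rfl⟩
  have hGu : ∀ u, (∫ y in (0:ℝ)..u, y * (u - y) * R (y, u - y)) = G u := fun u => by rw [hG]
  have hGc : Continuous G := by
    rw [hG]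
    apply continuous_parametric_intervalIntegral_of_continuous _ continuous_id
    unfold Function.uncurry; fun_prop
  -- symmetry
  have hsym : ∀ u, (∫ y in (0:ℝ)..u, y * (y * (u - y) * R (y, u - y))) = u / 2 * G u := by
    intro u
    have key : (∫ y in (0:ℝ)..u, y * (y * (u - y) * R (y, u - y)))
        = ∫ y in (0:ℝ)..u, (u - y) * (y * (u - y) * R (y, u - y)) := by
      have := integral_comp_sub_left (a := 0) (b := u)
        (fun y => y * (y * (u - y) * R (y, u - y))) u
      simp only [sub_self, sub_zero] at this
      rw [← this]
      apply integral_congr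
      intro y _
      simp only [sub_sub_cancel]
      rw [hsymm (u - y) y]; ring
    have hs : (∫ y in (0:ℝ)..u, y * (y * (u - y) * R (y, u - y)))
        + (∫ y in (0:ℝ)..u, (u - y) * (y * (u - y) * R (y, u - y))) = u * G u := by
      rw [← hGu, ← integral_const_mul, ← integral_add]
      · apply integral_congr; intro y _; ring
      · apply Continuous.intervalIntegrable; fun_prop
      · apply Continuous.intervalIntegrable; fun_prop
    linarith
  have hlin : ∀ k u, (∫ y in (0:ℝ)..u, (k + y) * (y * (u - y) * R (y, u - y)))
      = (k + u / 2) * G u := by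
    intro k u
    rw [add_mul, ← hsym, ← hGu, ← integral_const_mul, ← integral_add]
    · apply integral_congr; intro y _; ring
    · apply Continuous.intervalIntegrable; fun_prop
    · apply Continuous.intervalIntegrable; fun_prop
  obtain ⟨H, hH⟩ : ∃ H : ℝ → ℝ, H = fun s => ∫ u in (0:ℝ)..s, G u := ⟨_, rfl⟩
  have hHu : ∀ s, (∫ u in (0:ℝ)..s, G u) = H s := fun u => by rw [hH]
  have hHc : Continuous H := by
    rw [hH]
    exact continuous_primitive (fun _ _ => hGc.intervalIntegrable _ _) 0
  obtain ⟨J, hJ⟩ : ∃ J : ℝ → ℝ, J = fun s => ∫ v in (0:ℝ)..s, (s - v / 2 + (1 - a)) * G v := ⟨_, rfl⟩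
  have hJc : Continuous J := by
    rw [hJ]
    apply continuous_parametric_intervalIntegral_of_continuous _ continuous_id
    unfold Function.uncurry; fun_prop
  have hH0 : H 0 = 0 := by rw [hH]; simp
  have hG0 : G 0 = 0 := by rw [hG]; simp
  have h4 : (∫ t in (0:ℝ)..a, ∫ u in (0:ℝ)..t, ∫ y in (0:ℝ)..u,
          (t - y + 1 - a + (a - 1) / 2) * (u - y) * y * R (y, u - y))
      = ∫ t in (0:ℝ)..a, (J t - (1 - a) / 2 * H t) := by
    apply integral_congr; intro t _
    simp only [hJ, hH]
    rw [← integral_const_mul, ← integral_sub]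
    · apply integral_congr; intro u _
      have := hlin (-(t + 1 - a + (a - 1) / 2)) u
      have h2 : (∫ y in (0:ℝ)..u, (t - y + 1 - a + (a - 1) / 2) * (u - y) * y * R (y, u - y))
        = - ∫ y in (0:ℝ)..u, (-(t + 1 - a + (a - 1) / 2) + y) * (y * (u - y) * R (y, u - y)) := by
        rw [← integral_neg]; apply integral_congr; intro y _; ring
      simp only [h2, this]; ring
    · apply Continuous.intervalIntegrable; fun_prop
    · apply Continuous.intervalIntegrable; fun_prop
  have h2 : (∫ t in (0:ℝ)..2, ∫ u in (0:ℝ)..(max (a + t - 2) 0),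
          ∫ y in (0:ℝ)..u, (y * (u - y) / 2) * (a + t - 1) * R (y, u - y))
      = ∫ s in (0:ℝ)..a, (s + 1) / 2 * H s := by
    rw [shift_int _ (fun s => (s + 1) / 2 * H s) (by fun_prop) (2 - a) 2 (by linarith) (by linarith)]
    · simp
    · intro t ht
      rw [max_eq_right (by linarith)]; simp
    · intro s hs _
      rw [show a + (s + (2 - a)) - 2 = s by ring, max_eq_left hs, ← hHu, ← integral_const_mul]
      apply integral_congr; intro u _
      simp only [← hGu]
      rw [← integral_const_mul]
      apply integral_congr; intro y _; ring
  have h3 : (∫ t in (0:ℝ)..2, ∫ u in (0:ℝ)..t, ∫ y in (0:ℝ)..(max (a + u - 2) 0),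
          (t * y * (a + u - 2 - y) / 2) * R (y, a + u - 2 - y))
      = ∫ s in (0:ℝ)..a, (s + (2 - a)) / 2 * H s := by
    have e : ∀ t u : ℝ, (∫ y in (0:ℝ)..(max (a + u - 2) 0),
          (t * y * (a + u - 2 - y) / 2) * R (y, a + u - 2 - y)) = t / 2 * G (max (a + u - 2) 0) := by
      intro t u
      rcases le_total (a + u - 2) 0 with h | h
      · rw [max_eq_right h]; simp [hG0]
      · rw [max_eq_left h, ← hGu, ← integral_const_mul]
        apply integral_congr; intro y _; ring
    simp only [e, integral_const_mul]
    rw [shift_int _ (fun s => (s + (2 - a)) / 2 * H s) (by fun_prop) (2 - a) 2 (by linarith) (by linarith)]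
    · simp
    · intro t ht
      rcases le_total 0 t with h | h
      · have : (∫ u in (0:ℝ)..t, G (max (a + u - 2) 0)) = ∫ u in (0:ℝ)..t, (0:ℝ) := by
          apply integral_congr; intro u hu
          rw [Set.uIcc_of_le h] at hu
          simp only [max_eq_right (show a + u - 2 ≤ 0 by linarith [hu.2]), hG0]
        rw [this]; simp
      · have : (∫ u in (0:ℝ)..t, G (max (a + u - 2) 0)) = ∫ u in (0:ℝ)..t, (0:ℝ) := by
          apply integral_congr; intro u hu
          rw [Set.uIcc_of_ge h] at hu
          simp only [max_eq_right (show a + u - 2 ≤ 0 by linarith [hu.2]), hG0]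
        rw [this]; simp
    · intro s hs _
      rw [shift_int _ G hGc (2 - a) (s + (2 - a)) (by linarith) (by linarith)]
      · simp [hHu]
      · intro u hu; rw [max_eq_right (by linarith), hG0]
      · intro u hu _; rw [max_eq_left (by linarith)]; congr 1; ring
  have h1 : (∫ t in (0:ℝ)..2, ∫ y in (0:ℝ)..(max (t - 1) 0),
        ∫ u in (0:ℝ)..(max (y + a - 1) 0), y * u * (t - 1 - y) * R (u, t - 1 - y))
      = ∫ s in (0:ℝ)..a, J s := by
    rw [shift_int _ J hJc (2 - a) 2 (by linarith) (by linarith)]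
    · simp
    · intro t ht
      have : (∫ y in (0:ℝ)..(max (t - 1) 0),
        ∫ u in (0:ℝ)..(max (y + a - 1) 0), y * u * (t - 1 - y) * R (u, t - 1 - y))
          = ∫ y in (0:ℝ)..(max (t - 1) 0), (0:ℝ) := by
        apply integral_congr; intro y hy
        rw [Set.uIcc_of_le (le_max_right _ _)] at hy
        have : y ≤ 1 - a := hy.2.trans (max_le (by linarith) (by linarith))
        simp only [max_eq_right (show y + a - 1 ≤ 0 by linarith), integral_same]
      rw [this]; simp
    · intro r hr _
      rw [max_eq_left (by linarith)]
      rw [shift_int _ (fun z => ∫ u in (0:ℝ)..z, (z + (1 - a)) * (u * (r - z) * R (u, r - z))) ?_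
        (1 - a) (r + (2 - a) - 1) (by linarith) (by linarith)]
      · rw [show r + (2 - a) - 1 - (1 - a) = r by ring,
          tri_swap _ (by unfold Function.uncurry; fun_prop) r hr, hJ]
        have e1 : ∀ u : ℝ, (∫ z in u..r, (z + (1 - a)) * (u * (r - z) * R (u, r - z)))
            = ∫ v in u..r, (r - v + (1 - a) + u) * (u * (v - u) * R (u, v - u)) := by
          intro u
          have := integral_comp_sub_left (a := u) (b := r)
            (fun z => (z + (1 - a)) * (u * (r - z) * R (u, r - z))) (r + u)
          simp only [add_sub_cancel_left, add_sub_cancel_right] at this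
          rw [← this]
          apply integral_congr; intro v _
          simp only [show r - (r + u - v) = v - u by ring]
          ring
        simp only [e1]
        rw [← tri_swap (fun v u => (r - v + (1 - a) + u) * (u * (v - u) * R (u, v - u)))
          (by unfold Function.uncurry; fun_prop) r hr]
        apply integral_congr; intro v _
        simp only [hlin]; ring
      · intro y hy
        rw [max_eq_right (by linarith)]; simp
      · intro z hz _
        rw [max_eq_left (by linarith), show z + (1 - a) + a - 1 = z by ring,
          show r + (2 - a) - 1 - (z + (1 - a)) = r - z by ring]
        apply integral_congr; intro u _; ring
      · apply continuous_parametric_intervalIntegral_of_continuous _ continuous_id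
        unfold Function.uncurry; fun_prop
  rw [h1, h2, h3, h4, ← integral_add, ← integral_sub]
  · apply integral_congr; intro s _; ring
  all_goals apply Continuous.intervalIntegrable; fun_prop
end
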